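/- arXiv:2011.11852 — 2 statements merged into one kernel-verified Lean document; each statement's English description precedes it below -/
import Mathlib

section
/- For every mean-square stabilizing policy K ∈ 𝕂, the cost function C is continuously differentiable at K, and its gradient is given componentwise by ∇C(K)_i = 2 L^K_i 𝐗^K_i for i = 1,…,N. -/
open Matrix Filter
open scoped Kronecker Topology

namespace MJLS

noncomputable section

attribute [local instance] Classical.propDecidable

/-- Closed-loop matrices `Γ i = A i - B i * K i`. -/
def Gam {d k N : ℕ} (A : Fin N → Matrix (Fin d) (Fin d) ℝ)
    (B : Fin N → Matrix (Fin d) (Fin k) ℝ)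
    (K : Fin N → Matrix (Fin k) (Fin d) ℝ) : Fin N → Matrix (Fin d) (Fin d) ℝ :=
  fun i => A i - B i * K i

/-- The operator `E_i(V) = ∑ j, p i j • V j`. -/
def opE {d N : ℕ} (Pr : Matrix (Fin N) (Fin N) ℝ)
    (V : Fin N → Matrix (Fin d) (Fin d) ℝ) : Fin N → Matrix (Fin d) (Fin d) ℝ :=
  fun i => ∑ j, Pr i j • V j

/-- The matrix `𝒜 = diag(Γᵀ ⊗ Γᵀ) (P ⊗ I)`. -/
def calA {d N : ℕ} (Pr : Matrix (Fin N) (Fin N) ℝ)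
    (Γ : Fin N → Matrix (Fin d) (Fin d) ℝ) :
    Matrix (Fin N × Fin d × Fin d) (Fin N × Fin d × Fin d) ℝ :=
  (Matrix.reindex (Equiv.prodComm (Fin d × Fin d) (Fin N))
      (Equiv.prodComm (Fin d × Fin d) (Fin N))
      (Matrix.blockDiagonal fun i => (Γ i)ᵀ ⊗ₖ (Γ i)ᵀ)) *
    (Pr ⊗ₖ (1 : Matrix (Fin d × Fin d) (Fin d × Fin d) ℝ))

/-- `K` is mean-square stabilizing: the spectral radius of `𝒜` is less than `1`. -/
def MSS {d k N : ℕ} (Pr : Matrix (Fin N) (Fin N) ℝ)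
    (A : Fin N → Matrix (Fin d) (Fin d) ℝ) (B : Fin N → Matrix (Fin d) (Fin k) ℝ)
    (K : Fin N → Matrix (Fin k) (Fin d) ℝ) : Prop :=
  spectralRadius ℂ ((calA Pr (Gam A B K)).map (algebraMap ℝ ℂ)) < 1

/-- `P` solves the coupled Lyapunov equations for the policy `K`. -/
def IsLyap {d k N : ℕ} (Pr : Matrix (Fin N) (Fin N) ℝ)
    (A : Fin N → Matrix (Fin d) (Fin d) ℝ) (B : Fin N → Matrix (Fin d) (Fin k) ℝ)
    (Q : Fin N → Matrix (Fin d) (Fin d) ℝ) (R : Fin N → Matrix (Fin k) (Fin k) ℝ)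
    (K : Fin N → Matrix (Fin k) (Fin d) ℝ)
    (P : Fin N → Matrix (Fin d) (Fin d) ℝ) : Prop :=
  ∀ i, P i = Q i + (K i)ᵀ * R i * K i + (Gam A B K i)ᵀ * opE Pr P i * Gam A B K i

/-- `P^K`, the (for mean-square stabilizing `K`, unique) solution of the coupled
Lyapunov equations. -/
def PK {d k N : ℕ} (Pr : Matrix (Fin N) (Fin N) ℝ)
    (A : Fin N → Matrix (Fin d) (Fin d) ℝ) (B : Fin N → Matrix (Fin d) (Fin k) ℝ)
    (Q : Fin N → Matrix (Fin d) (Fin d) ℝ) (R : Fin N → Matrix (Fin k) (Fin k) ℝ)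
    (K : Fin N → Matrix (Fin k) (Fin d) ℝ) : Fin N → Matrix (Fin d) (Fin d) ℝ :=
  if h : ∃ P, IsLyap Pr A B Q R K P then h.choose else 0

/-- The LQR cost `C(K) = ∑ i, π i * tr(P^K_i Sg)`. -/
def cost {d k N : ℕ} (Pr : Matrix (Fin N) (Fin N) ℝ)
    (A : Fin N → Matrix (Fin d) (Fin d) ℝ) (B : Fin N → Matrix (Fin d) (Fin k) ℝ)
    (Q : Fin N → Matrix (Fin d) (Fin d) ℝ) (R : Fin N → Matrix (Fin k) (Fin k) ℝ)
    (piv : Fin N → ℝ) (Sg : Matrix (Fin d) (Fin d) ℝ)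
    (K : Fin N → Matrix (Fin k) (Fin d) ℝ) : ℝ :=
  ∑ i, piv i * (PK Pr A B Q R K i * Sg).trace

/-- The operator `T_j(V) = ∑ i, p i j • (Γ i * V i * Γ iᵀ)`. -/
def opT {d N : ℕ} (Pr : Matrix (Fin N) (Fin N) ℝ)
    (Γ : Fin N → Matrix (Fin d) (Fin d) ℝ)
    (V : Fin N → Matrix (Fin d) (Fin d) ℝ) : Fin N → Matrix (Fin d) (Fin d) ℝ :=
  fun j => ∑ i, Pr i j • (Γ i * V i * (Γ i)ᵀ)

/-- `𝐗^K = ∑_{t=0}^∞ T^t(X(0))` with `X_i(0) = π i • Sg`. -/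
def XK {d N : ℕ} (Pr : Matrix (Fin N) (Fin N) ℝ) (piv : Fin N → ℝ)
    (Sg : Matrix (Fin d) (Fin d) ℝ) (Γ : Fin N → Matrix (Fin d) (Fin d) ℝ) :
    Fin N → Matrix (Fin d) (Fin d) ℝ :=
  ∑' t : ℕ, (opT Pr Γ)^[t] (fun i => piv i • Sg)

/-- `L^K_i = (R i + B iᵀ E_i(P^K) B i) K i - B iᵀ E_i(P^K) A i`. -/
def LK {d k N : ℕ} (Pr : Matrix (Fin N) (Fin N) ℝ)
    (A : Fin N → Matrix (Fin d) (Fin d) ℝ) (B : Fin N → Matrix (Fin d) (Fin k) ℝ)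
    (Q : Fin N → Matrix (Fin d) (Fin d) ℝ) (R : Fin N → Matrix (Fin k) (Fin k) ℝ)
    (K : Fin N → Matrix (Fin k) (Fin d) ℝ) : Fin N → Matrix (Fin k) (Fin d) ℝ :=
  fun i => (R i + (B i)ᵀ * opE Pr (PK Pr A B Q R K) i * B i) * K i
    - (B i)ᵀ * opE Pr (PK Pr A B Q R K) i * A i

/-- The operator `L_i(V) = Γ iᵀ E_i(V) Γ i`. -/
def opL {d N : ℕ} (Pr : Matrix (Fin N) (Fin N) ℝ)
    (Γ : Fin N → Matrix (Fin d) (Fin d) ℝ)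
    (V : Fin N → Matrix (Fin d) (Fin d) ℝ) : Fin N → Matrix (Fin d) (Fin d) ℝ :=
  fun i => (Γ i)ᵀ * opE Pr V i * Γ i

/-- `(P^K)'[E] = ∑_{t=0}^∞ L^t(Eᵀ L^K + (L^K)ᵀ E)`. -/
def PKd {d k N : ℕ} (Pr : Matrix (Fin N) (Fin N) ℝ)
    (Γ : Fin N → Matrix (Fin d) (Fin d) ℝ)
    (Lk E : Fin N → Matrix (Fin k) (Fin d) ℝ) : Fin N → Matrix (Fin d) (Fin d) ℝ :=
  ∑' t : ℕ, (opL Pr Γ)^[t] (fun i => (E i)ᵀ * Lk i + (Lk i)ᵀ * E i)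

/-- `‖V‖₂² = ∑ i, tr(V iᵀ V i)`. -/
def norm2sq {a b N : ℕ} (V : Fin N → Matrix (Fin a) (Fin b) ℝ) : ℝ :=
  ∑ i, ((V i)ᵀ * V i).trace

/-- The inner product `⟨V, S⟩ = ∑ i, tr(V iᵀ S i)`. -/
def ip {a b N : ℕ} (V S : Fin N → Matrix (Fin a) (Fin b) ℝ) : ℝ :=
  ∑ i, ((V i)ᵀ * S i).trace

/-- The spectral norm (maximal singular value) of a matrix. -/
def specNorm {a b : ℕ} (M : Matrix (Fin a) (Fin b) ℝ) : ℝ :=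
  ⨆ x : {x : EuclideanSpace ℝ (Fin b) // ‖x‖ ≤ 1}, ‖Matrix.toEuclideanLin M x.1‖

/-- The minimal singular value of a square matrix. -/
def sigmaMin {a : ℕ} (M : Matrix (Fin a) (Fin a) ℝ) : ℝ :=
  ⨅ x : {x : EuclideanSpace ℝ (Fin a) // ‖x‖ = 1}, ‖Matrix.toEuclideanLin M x.1‖

/-- `‖V‖_max = max_i ‖V i‖` (spectral norms). -/
def maxNorm {a b N : ℕ} (V : Fin N → Matrix (Fin a) (Fin b) ℝ) : ℝ :=
  ⨆ i, specNorm (V i)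

/-- `Λ_min(V) = min_i σ_min(V i)`. -/
def lamMin {a N : ℕ} (V : Fin N → Matrix (Fin a) (Fin a) ℝ) : ℝ :=
  ⨅ i, sigmaMin (V i)

/-- `μ = (min_i π i) · σ_min(Sg)`. -/
def mu {d N : ℕ} (piv : Fin N → ℝ) (Sg : Matrix (Fin d) (Fin d) ℝ) : ℝ :=
  (⨅ i, piv i) * sigmaMin Sg

/-- `ξ(α) = (1/Λ_min(Q))·((1 + ‖B‖²_max)·α/μ + ‖R‖_max) − 1`. -/
def xi {d k N : ℕ} (B : Fin N → Matrix (Fin d) (Fin k) ℝ)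
    (R : Fin N → Matrix (Fin k) (Fin k) ℝ) (Q : Fin N → Matrix (Fin d) (Fin d) ℝ)
    (piv : Fin N → ℝ) (Sg : Matrix (Fin d) (Fin d) ℝ) (α : ℝ) : ℝ :=
  (1 / lamMin Q) * ((1 + maxNorm B ^ 2) * α / mu piv Sg + maxNorm R) - 1

/-- The smoothness constant
`L(α) = 2·(‖R‖_max + ‖B‖²_max·(1 + 2ξ(α)/‖B‖_max)·α/μ)·α/Λ_min(Q)`. -/
def Lsm {d k N : ℕ} (B : Fin N → Matrix (Fin d) (Fin k) ℝ)
    (R : Fin N → Matrix (Fin k) (Fin k) ℝ) (Q : Fin N → Matrix (Fin d) (Fin d) ℝ)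
    (piv : Fin N → ℝ) (Sg : Matrix (Fin d) (Fin d) ℝ) (α : ℝ) : ℝ :=
  2 * (maxNorm R + maxNorm B ^ 2 * (1 + 2 * xi B R Q piv Sg α / maxNorm B)
      * α / mu piv Sg) * α / lamMin Q

end

section specsum

attribute [local instance] Matrix.linftyOpNormedRing Matrix.linftyOpNormedAlgebra

theorem summable_pow_entry {ι : Type*} [Fintype ι] [DecidableEq ι] (M : Matrix ι ι ℝ)
    (h : spectralRadius ℂ (M.map (algebraMap ℝ ℂ)) < 1) (a b : ι) :
    Summable fun t : ℕ => (M ^ t) a b := by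
  set Mc : Matrix ι ι ℂ := M.map (algebraMap ℝ ℂ) with hMc
  have hlim := spectrum.pow_nnnorm_pow_one_div_tendsto_nhds_spectralRadius Mc
  obtain ⟨r, hr1, hr2⟩ := exists_between h
  have hrtop : r ≠ ⊤ := (hr2.trans ENNReal.one_lt_top).ne
  have hev := hlim.eventually (gt_mem_nhds hr1)
  have hsum : Summable fun t : ℕ => Mc ^ t := by
    refine Summable.of_norm_bounded_eventually_nat (g := fun t => r.toReal ^ t) ?_ ?_
    · apply summable_geometric_of_lt_one ENNReal.toReal_nonneg
      have := (ENNReal.toReal_lt_toReal hrtop ENNReal.one_ne_top).2 hr2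
      simpa using this
    · filter_upwards [hev, eventually_gt_atTop 0] with n hn hn0
      have hn' : (n : ℝ) ≠ 0 := by exact_mod_cast hn0.ne'
      have h1 : ((‖Mc ^ n‖₊ : ENNReal)) ≤ r ^ n := by
        have := ENNReal.rpow_le_rpow hn.le (Nat.cast_nonneg (α := ℝ) n)
        rw [← ENNReal.rpow_mul, one_div, inv_mul_cancel₀ hn', ENNReal.rpow_one,
          ENNReal.rpow_natCast] at this
        exact this
      have h2 := ENNReal.toReal_mono (ENNReal.pow_ne_top hrtop) h1
      simpa using h2
  have h1 : Summable fun t : ℕ => (Mc ^ t) a b :=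
    (Pi.summable.1 ((Pi.summable.1 hsum) a)) b
  have h2 : (fun t : ℕ => (Mc ^ t) a b) = fun t : ℕ => (((M ^ t) a b : ℝ) : ℂ) := by
    funext t
    have : Mc ^ t = (M ^ t).map (algebraMap ℝ ℂ) := by
      have := map_pow (RingHom.mapMatrix (m := ι) (algebraMap ℝ ℂ)) M t
      simpa [hMc] using this.symm
    rw [this]; rfl
  rw [h2] at h1
  exact Complex.summable_ofReal.1 h1

end specsum

section vecs
variable {d N : ℕ}

/-- Vectorisation of a tuple. -/
def vecT (V : Fin N → Matrix (Fin d) (Fin d) ℝ) : Fin N × Fin d × Fin d → ℝ :=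
  fun x => V x.1 x.2.1 x.2.2

theorem calA_apply (Pr : Matrix (Fin N) (Fin N) ℝ) (Γ : Fin N → Matrix (Fin d) (Fin d) ℝ)
    (x y : Fin N × Fin d × Fin d) :
    calA Pr Γ x y = Γ x.1 y.2.1 x.2.1 * Γ x.1 y.2.2 x.2.2 * Pr x.1 y.1 := by
  obtain ⟨i, a, b⟩ := x
  obtain ⟨j, c, e⟩ := y
  rw [calA, Matrix.mul_apply, Fintype.sum_prod_type, Finset.sum_eq_single i]
  · rw [Finset.sum_eq_single (c, e)]
    · simp [Matrix.blockDiagonal_apply, Matrix.kroneckerMap_apply]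
    · rintro ⟨c', e'⟩ - h
      simp [Matrix.kroneckerMap_apply, h]
    · simp
  · intro i' _ h
    apply Finset.sum_eq_zero
    intro z _
    simp [Matrix.blockDiagonal_apply, h.symm]
  · simp

theorem vec_opL (Pr : Matrix (Fin N) (Fin N) ℝ) (Γ : Fin N → Matrix (Fin d) (Fin d) ℝ)
    (V : Fin N → Matrix (Fin d) (Fin d) ℝ) :
    vecT (opL Pr Γ V) = calA Pr Γ *ᵥ vecT V := by
  funext ⟨i, a, b⟩
  simp only [vecT, opL, opE, Matrix.mulVec, dotProduct, calA_apply, Fintype.sum_prod_type,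
    Matrix.mul_apply, Matrix.transpose_apply, Matrix.sum_apply, Matrix.smul_apply, smul_eq_mul,
    Finset.mul_sum, Finset.sum_mul]
  rw [Finset.sum_comm]
  refine Finset.sum_congr rfl fun c _ => ?_
  rw [Finset.sum_comm]
  refine Finset.sum_congr rfl fun j _ => Finset.sum_congr rfl fun e _ => ?_
  ring

theorem vec_opT (Pr : Matrix (Fin N) (Fin N) ℝ) (Γ : Fin N → Matrix (Fin d) (Fin d) ℝ)
    (V : Fin N → Matrix (Fin d) (Fin d) ℝ) :
    vecT (opT Pr Γ V) = (calA Pr Γ)ᵀ *ᵥ vecT V := by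
  funext ⟨i, a, b⟩
  simp only [vecT, opT, Matrix.mulVec, dotProduct, calA_apply, Fintype.sum_prod_type,
    Matrix.mul_apply, Matrix.transpose_apply, Matrix.sum_apply, Matrix.smul_apply, smul_eq_mul,
    Finset.mul_sum, Finset.sum_mul]
  refine Finset.sum_congr rfl fun j _ => ?_
  rw [Finset.sum_comm]
  refine Finset.sum_congr rfl fun c _ => Finset.sum_congr rfl fun e _ => ?_
  ring

theorem vec_opT_iter (Pr : Matrix (Fin N) (Fin N) ℝ) (Γ : Fin N → Matrix (Fin d) (Fin d) ℝ)
    (V : Fin N → Matrix (Fin d) (Fin d) ℝ) (t : ℕ) :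
    vecT ((opT Pr Γ)^[t] V) = ((calA Pr Γ) ^ t)ᵀ *ᵥ vecT V := by
  induction t with
  | zero => simp
  | succ n ih =>
    rw [Function.iterate_succ_apply', vec_opT, ih, Matrix.mulVec_mulVec, pow_succ,
      Matrix.transpose_mul]

theorem opL_fix_zero (Pr : Matrix (Fin N) (Fin N) ℝ) (Γ : Fin N → Matrix (Fin d) (Fin d) ℝ)
    (h : spectralRadius ℂ ((calA Pr Γ).map (algebraMap ℝ ℂ)) < 1)
    (V : Fin N → Matrix (Fin d) (Fin d) ℝ) (hV : opL Pr Γ V = V) : V = 0 := by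
  have h0 : ∀ t : ℕ, vecT V = (calA Pr Γ) ^ t *ᵥ vecT V := by
    intro t
    induction t with
    | zero => simp
    | succ n ih =>
      rw [pow_succ, ← Matrix.mulVec_mulVec, ← vec_opL, hV, ← ih]
  funext i
  ext a b
  have h1 : Summable fun t : ℕ => ((calA Pr Γ) ^ t *ᵥ vecT V) (i, a, b) := by
    simp only [Matrix.mulVec, dotProduct]
    exact summable_sum fun y _ => (summable_pow_entry _ h _ _).mul_right _
  have h2 := h1.tendsto_atTop_zero
  have h3 : (fun t : ℕ => ((calA Pr Γ) ^ t *ᵥ vecT V) (i, a, b)) = fun _ => V i a b := by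
    funext t
    rw [← h0 t]; rfl
  rw [h3] at h2
  exact tendsto_nhds_unique tendsto_const_nhds h2

theorem summable_opT (Pr : Matrix (Fin N) (Fin N) ℝ) (Γ : Fin N → Matrix (Fin d) (Fin d) ℝ)
    (h : spectralRadius ℂ ((calA Pr Γ).map (algebraMap ℝ ℂ)) < 1)
    (V : Fin N → Matrix (Fin d) (Fin d) ℝ) : Summable fun t : ℕ => (opT Pr Γ)^[t] V := by
  refine Pi.summable.2 fun i => Pi.summable.2 fun a => Pi.summable.2 fun b => ?_
  have h3 : (fun t : ℕ => ((opT Pr Γ)^[t] V) i a b)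
      = fun t : ℕ => (((calA Pr Γ) ^ t)ᵀ *ᵥ vecT V) (i, a, b) := by
    funext t
    rw [← vec_opT_iter]; rfl
  refine (congrArg Summable h3).mpr ?_
  simp only [Matrix.mulVec, dotProduct, Matrix.transpose_apply]
  exact summable_sum fun y _ => (summable_pow_entry _ h _ _).mul_right _

theorem ip_vec (V S : Fin N → Matrix (Fin d) (Fin d) ℝ) : ip V S = vecT V ⬝ᵥ vecT S := by
  simp only [ip, vecT, dotProduct, Matrix.trace, Matrix.diag, Matrix.mul_apply,
    Matrix.transpose_apply, Fintype.sum_prod_type]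
  exact Finset.sum_congr rfl fun i _ => Finset.sum_comm

theorem ip_opT (Pr : Matrix (Fin N) (Fin N) ℝ) (Γ : Fin N → Matrix (Fin d) (Fin d) ℝ)
    (V S : Fin N → Matrix (Fin d) (Fin d) ℝ) : ip (opT Pr Γ V) S = ip V (opL Pr Γ S) := by
  rw [ip_vec, ip_vec, vec_opT, vec_opL, Matrix.mulVec_transpose, Matrix.dotProduct_mulVec]

theorem opT_symm (Pr : Matrix (Fin N) (Fin N) ℝ) (Γ : Fin N → Matrix (Fin d) (Fin d) ℝ)
    (V : Fin N → Matrix (Fin d) (Fin d) ℝ) (hV : ∀ i, (V i)ᵀ = V i) (t : ℕ) (i : Fin N) :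
    ((opT Pr Γ)^[t] V i)ᵀ = (opT Pr Γ)^[t] V i := by
  induction t generalizing i with
  | zero => exact hV i
  | succ n ih =>
    rw [Function.iterate_succ_apply']
    simp only [opT, Matrix.transpose_sum, Matrix.transpose_smul, Matrix.transpose_mul,
      Matrix.transpose_transpose, Matrix.mul_assoc]
    refine Finset.sum_congr rfl fun j _ => ?_
    rw [ih j]

theorem opT_continuous (Pr : Matrix (Fin N) (Fin N) ℝ) (Γ : Fin N → Matrix (Fin d) (Fin d) ℝ) :
    Continuous (opT Pr Γ) := by
  unfold opT
  fun_prop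

/-- `opT` as an additive map. -/
def opTadd (Pr : Matrix (Fin N) (Fin N) ℝ) (Γ : Fin N → Matrix (Fin d) (Fin d) ℝ) :
    (Fin N → Matrix (Fin d) (Fin d) ℝ) →+ (Fin N → Matrix (Fin d) (Fin d) ℝ) where
  toFun := opT Pr Γ
  map_zero' := by funext i; simp [opT]
  map_add' V S := by
    funext i
    simp [opT, Matrix.mul_add, Matrix.add_mul, Finset.sum_add_distrib]

theorem XK_eq (Pr : Matrix (Fin N) (Fin N) ℝ) (Γ : Fin N → Matrix (Fin d) (Fin d) ℝ)
    (h : spectralRadius ℂ ((calA Pr Γ).map (algebraMap ℝ ℂ)) < 1)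
    (piv : Fin N → ℝ) (Sg : Matrix (Fin d) (Fin d) ℝ) :
    XK Pr piv Sg Γ = (fun i => piv i • Sg) + opT Pr Γ (XK Pr piv Sg Γ) := by
  have hs := summable_opT Pr Γ h (fun i => piv i • Sg)
  have h1 : opT Pr Γ (XK Pr piv Sg Γ)
      = ∑' t : ℕ, opT Pr Γ ((opT Pr Γ)^[t] (fun i => piv i • Sg)) :=
    hs.map_tsum (opTadd Pr Γ) (opT_continuous Pr Γ)
  rw [h1]
  conv_lhs => rw [XK, hs.tsum_eq_zero_add]
  simp only [Function.iterate_succ_apply', Function.iterate_zero, id]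

theorem XK_symm (Pr : Matrix (Fin N) (Fin N) ℝ) (Γ : Fin N → Matrix (Fin d) (Fin d) ℝ)
    (h : spectralRadius ℂ ((calA Pr Γ).map (algebraMap ℝ ℂ)) < 1)
    (piv : Fin N → ℝ) (Sg : Matrix (Fin d) (Fin d) ℝ) (hS : Sgᵀ = Sg) (i : Fin N) :
    (XK Pr piv Sg Γ i)ᵀ = XK Pr piv Sg Γ i := by
  have hs := summable_opT Pr Γ h (fun i => piv i • Sg)
  have h1 : XK Pr piv Sg Γ i = ∑' t : ℕ, ((opT Pr Γ)^[t] (fun i => piv i • Sg)) i :=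
    tsum_apply hs
  rw [h1, Matrix.transpose_tsum]
  exact tsum_congr fun t => opT_symm Pr Γ _ (fun i => by simp [hS]) t i

end vecs



section main
variable {d k N : ℕ}

/-- Tuples of matrices as plain functions (sup norm). -/
abbrev Tup (a b N : ℕ) : Type := Fin N → Fin a → Fin b → ℝ

theorem opL_add (Pr : Matrix (Fin N) (Fin N) ℝ) (Γ V S : Fin N → Matrix (Fin d) (Fin d) ℝ) :
    opL Pr Γ (V + S) = opL Pr Γ V + opL Pr Γ S := by
  funext i
  simp [opL, opE, Matrix.mul_add, Matrix.add_mul, Finset.sum_add_distrib]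

theorem opL_smul (Pr : Matrix (Fin N) (Fin N) ℝ) (Γ : Fin N → Matrix (Fin d) (Fin d) ℝ)
    (c : ℝ) (V : Fin N → Matrix (Fin d) (Fin d) ℝ) :
    opL Pr Γ (c • V) = c • opL Pr Γ V := by
  funext i
  simp only [opL, opE, Pi.smul_apply]
  have : ∑ j, Pr i j • c • V j = c • ∑ j, Pr i j • V j := by
    rw [Finset.smul_sum]
    exact Finset.sum_congr rfl fun j _ => smul_comm _ _ _
  rw [this, Matrix.mul_smul, Matrix.smul_mul]

/-- `opL` as a continuous linear map. -/
noncomputable def opLc (Pr : Matrix (Fin N) (Fin N) ℝ)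
    (Γ : Fin N → Matrix (Fin d) (Fin d) ℝ) :
    Tup d d N →L[ℝ] Tup d d N :=
  LinearMap.toContinuousLinearMap
    { toFun := fun V : Tup d d N => (opL Pr Γ V : Tup d d N)
      map_add' := opL_add Pr Γ
      map_smul' := opL_smul Pr Γ }

theorem opLc_apply (Pr : Matrix (Fin N) (Fin N) ℝ)
    (Γ V : Fin N → Matrix (Fin d) (Fin d) ℝ) : opLc Pr Γ V = opL Pr Γ V := rfl

/-- The stage cost term (matrix version). -/
def cstM (Q : Fin N → Matrix (Fin d) (Fin d) ℝ) (R : Fin N → Matrix (Fin k) (Fin k) ℝ)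
    (K : Fin N → Matrix (Fin k) (Fin d) ℝ) : Fin N → Matrix (Fin d) (Fin d) ℝ :=
  fun i => Q i + (K i)ᵀ * R i * K i

/-- The stage cost term. -/
def cst (Q : Fin N → Matrix (Fin d) (Fin d) ℝ) (R : Fin N → Matrix (Fin k) (Fin k) ℝ)
    (K : Tup k d N) : Tup d d N :=
  cstM Q R K

/-- `PK` on plain functions. -/
noncomputable def PKt (Pr : Matrix (Fin N) (Fin N) ℝ)
    (A : Fin N → Matrix (Fin d) (Fin d) ℝ) (B : Fin N → Matrix (Fin d) (Fin k) ℝ)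
    (Q : Fin N → Matrix (Fin d) (Fin d) ℝ) (R : Fin N → Matrix (Fin k) (Fin k) ℝ)
    (K : Tup k d N) : Tup d d N := PK Pr A B Q R K

/-- `opLc` as a function of the policy. -/
noncomputable def opLK (Pr : Matrix (Fin N) (Fin N) ℝ)
    (A : Fin N → Matrix (Fin d) (Fin d) ℝ) (B : Fin N → Matrix (Fin d) (Fin k) ℝ)
    (K : Tup k d N) : Tup d d N →L[ℝ] Tup d d N := opLc Pr (Gam A B K)

theorem contDiff_entry (i : Fin N) (a : Fin k) (b : Fin d) :
    ContDiff ℝ 1 (fun K : Tup k d N => K i a b) := by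
  fun_prop

theorem contDiff_tuple {f : Tup k d N → Tup d d N}
    (h : ∀ i a b, ContDiff ℝ 1 fun K => f K i a b) : ContDiff ℝ 1 f :=
  contDiff_pi.2 fun i => contDiff_pi.2 fun a => contDiff_pi.2 fun b => h i a b

theorem cstM_apply (Q : Fin N → Matrix (Fin d) (Fin d) ℝ) (R : Fin N → Matrix (Fin k) (Fin k) ℝ)
    (K : Fin N → Matrix (Fin k) (Fin d) ℝ) (i : Fin N) (a b : Fin d) :
    cstM Q R K i a b = Q i a b + ∑ x, (∑ y, K i y a * R i y x) * K i x b := by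
  simp only [cstM, Matrix.add_apply, Matrix.mul_apply, Matrix.transpose_apply]

theorem opL_entry (Pr : Matrix (Fin N) (Fin N) ℝ)
    (A : Fin N → Matrix (Fin d) (Fin d) ℝ) (B : Fin N → Matrix (Fin d) (Fin k) ℝ)
    (K : Fin N → Matrix (Fin k) (Fin d) ℝ) (V : Fin N → Matrix (Fin d) (Fin d) ℝ)
    (i : Fin N) (a b : Fin d) :
    opL Pr (Gam A B K) V i a b
      = ∑ x, (∑ y, (A i y a - ∑ z, B i y z * K i z a) * opE Pr V i y x)
        * (A i x b - ∑ z, B i x z * K i z b) := by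
  simp only [opL, Gam, Matrix.mul_apply, Matrix.transpose_apply, Matrix.sub_apply]

theorem contDiff_cst (Q : Fin N → Matrix (Fin d) (Fin d) ℝ)
    (R : Fin N → Matrix (Fin k) (Fin k) ℝ) :
    ContDiff ℝ 1 (cst Q R) := by
  refine contDiff_tuple fun i a b => ?_
  have e : (fun K : Tup k d N => cst Q R K i a b)
      = fun K : Tup k d N => Q i a b + ∑ x, (∑ y, K i y a * R i y x) * K i x b := by
    funext K
    exact cstM_apply Q R K i a b
  rw [e]
  fun_prop

theorem contDiff_opLc (Pr : Matrix (Fin N) (Fin N) ℝ)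
    (A : Fin N → Matrix (Fin d) (Fin d) ℝ) (B : Fin N → Matrix (Fin d) (Fin k) ℝ) :
    ContDiff ℝ 1 (opLK Pr A B) := by
  refine contDiff_clm_apply_iff.2 fun V => contDiff_tuple fun i a b => ?_
  have e : (fun K : Tup k d N => opLK Pr A B K V i a b)
      = fun K : Tup k d N => ∑ x, (∑ y, (A i y a - ∑ z, B i y z * K i z a) * opE Pr V i y x)
        * (A i x b - ∑ z, B i x z * K i z b) := by
    funext K
    change opL Pr (Gam A B K) V i a b = _
    exact opL_entry Pr A B K V i a b
  rw [e]
  fun_prop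

theorem isUnit_of_MSS (Pr : Matrix (Fin N) (Fin N) ℝ) (Γ : Fin N → Matrix (Fin d) (Fin d) ℝ)
    (h : spectralRadius ℂ ((calA Pr Γ).map (algebraMap ℝ ℂ)) < 1) :
    IsUnit (1 - opLc Pr Γ : Tup d d N →L[ℝ] Tup d d N) := by
  rw [ContinuousLinearMap.isUnit_iff_bijective]
  have hinj : Function.Injective ⇑(1 - opLc Pr Γ : Tup d d N →L[ℝ] Tup d d N) := by
    rw [injective_iff_map_eq_zero]
    intro V hV
    apply opL_fix_zero Pr Γ h
    rw [_root_.sub_apply, sub_eq_zero] at hV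
    exact hV.symm
  exact ⟨hinj, LinearMap.injective_iff_surjective
    (f := ((1 - opLc Pr Γ : Tup d d N →L[ℝ] Tup d d N) : Tup d d N →ₗ[ℝ] Tup d d N)).1 hinj⟩

theorem isLyap_iff (Pr : Matrix (Fin N) (Fin N) ℝ)
    (A : Fin N → Matrix (Fin d) (Fin d) ℝ) (B : Fin N → Matrix (Fin d) (Fin k) ℝ)
    (Q : Fin N → Matrix (Fin d) (Fin d) ℝ) (R : Fin N → Matrix (Fin k) (Fin k) ℝ)
    (K : Tup k d N) (P : Tup d d N) :
    IsLyap Pr A B Q R K P ↔ (1 - opLK Pr A B K) P = cst Q R K := by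
  rw [_root_.sub_apply, sub_eq_iff_eq_add]
  exact funext_iff.symm

theorem isLyap_iff_inv (Pr : Matrix (Fin N) (Fin N) ℝ)
    (A : Fin N → Matrix (Fin d) (Fin d) ℝ) (B : Fin N → Matrix (Fin d) (Fin k) ℝ)
    (Q : Fin N → Matrix (Fin d) (Fin d) ℝ) (R : Fin N → Matrix (Fin k) (Fin k) ℝ)
    (K : Tup k d N) (h : IsUnit (1 - opLK Pr A B K))
    (P : Tup d d N) :
    IsLyap Pr A B Q R K P ↔ P = Ring.inverse (1 - opLK Pr A B K) (cst Q R K) := by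
  rw [isLyap_iff]
  constructor
  · intro hP
    rw [← hP]
    exact (congrArg (fun f : Tup d d N →L[ℝ] Tup d d N => f P) (Ring.inverse_mul_cancel _ h)).symm
  · rintro rfl
    exact congrArg (fun f : Tup d d N →L[ℝ] Tup d d N => f (cst Q R K))
      (Ring.mul_inverse_cancel _ h)

theorem PK_isLyap (Pr : Matrix (Fin N) (Fin N) ℝ)
    (A : Fin N → Matrix (Fin d) (Fin d) ℝ) (B : Fin N → Matrix (Fin d) (Fin k) ℝ)
    (Q : Fin N → Matrix (Fin d) (Fin d) ℝ) (R : Fin N → Matrix (Fin k) (Fin k) ℝ)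
    (K : Fin N → Matrix (Fin k) (Fin d) ℝ) (h : IsUnit (1 - opLK Pr A B K)) :
    IsLyap Pr A B Q R K (PK Pr A B Q R K) := by
  have hex : ∃ P, IsLyap Pr A B Q R K P := ⟨_, (isLyap_iff_inv Pr A B Q R K h _).2 rfl⟩
  rw [PK, dif_pos hex]
  exact hex.choose_spec

theorem eventually_isUnit (Pr : Matrix (Fin N) (Fin N) ℝ)
    (A : Fin N → Matrix (Fin d) (Fin d) ℝ) (B : Fin N → Matrix (Fin d) (Fin k) ℝ)
    (K : Fin N → Matrix (Fin k) (Fin d) ℝ) (h : IsUnit (1 - opLK Pr A B K)) :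
    ∀ᶠ K' : Tup k d N in 𝓝 (K : Tup k d N), IsUnit (1 - opLK Pr A B K') := by
  have hc : Continuous fun K' : Tup k d N => 1 - opLK Pr A B K' :=
    continuous_const.sub (contDiff_opLc Pr A B).continuous
  exact hc.continuousAt.eventually (Units.isOpen.mem_nhds h)

theorem contDiffAt_PK (Pr : Matrix (Fin N) (Fin N) ℝ)
    (A : Fin N → Matrix (Fin d) (Fin d) ℝ) (B : Fin N → Matrix (Fin d) (Fin k) ℝ)
    (Q : Fin N → Matrix (Fin d) (Fin d) ℝ) (R : Fin N → Matrix (Fin k) (Fin k) ℝ)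
    (K : Tup k d N) (h : IsUnit (1 - opLK Pr A B K)) :
    ContDiffAt ℝ 1 (PKt Pr A B Q R) K := by
  have h1 : ContDiffAt ℝ 1
      (fun K' : Tup k d N => Ring.inverse (1 - opLK Pr A B K') (cst Q R K')) K := by
    refine ContDiffAt.clm_apply ?_ (contDiff_cst Q R).contDiffAt
    obtain ⟨u, hu⟩ := h
    have h2 : ContDiffAt ℝ 1 Ring.inverse (1 - opLK Pr A B K) := by
      rw [← hu]; exact contDiffAt_ringInverse ℝ u
    exact h2.comp K (contDiff_const.sub (contDiff_opLc Pr A B)).contDiffAt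
  refine h1.congr_of_eventuallyEq ?_
  filter_upwards [eventually_isUnit Pr A B K h] with K' hK'
  exact (isLyap_iff_inv Pr A B Q R K' hK' _).1 (PK_isLyap Pr A B Q R K' hK')

theorem PK_symm (Pr : Matrix (Fin N) (Fin N) ℝ)
    (A : Fin N → Matrix (Fin d) (Fin d) ℝ) (B : Fin N → Matrix (Fin d) (Fin k) ℝ)
    (Q : Fin N → Matrix (Fin d) (Fin d) ℝ) (R : Fin N → Matrix (Fin k) (Fin k) ℝ)
    (hQ : ∀ i, (Q i)ᵀ = Q i) (hR : ∀ i, (R i)ᵀ = R i)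
    (K : Fin N → Matrix (Fin k) (Fin d) ℝ) (h : IsUnit (1 - opLK Pr A B K)) (i : Fin N) :
    (PK Pr A B Q R K i)ᵀ = PK Pr A B Q R K i := by
  have h1 := PK_isLyap Pr A B Q R K h
  have h2 : IsLyap Pr A B Q R K (fun i => (PK Pr A B Q R K i)ᵀ) := by
    intro i
    have hE : opE Pr (fun i => (PK Pr A B Q R K i)ᵀ) i = (opE Pr (PK Pr A B Q R K) i)ᵀ := by
      simp [opE, Matrix.transpose_sum, Matrix.transpose_smul]
    rw [hE]
    refine (congrArg Matrix.transpose (h1 i)).trans ?_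
    simp only [Matrix.transpose_add, Matrix.transpose_mul, Matrix.transpose_transpose, hQ, hR,
      Matrix.mul_assoc]
  have h3 := ((isLyap_iff_inv Pr A B Q R K h _).1 h2).trans
    ((isLyap_iff_inv Pr A B Q R K h _).1 h1).symm
  exact congrFun h3 i

/-- The difference-quotient map. -/
def Phi (Pr : Matrix (Fin N) (Fin N) ℝ)
    (Γ : Fin N → Matrix (Fin d) (Fin d) ℝ) (BE S M : Fin N → Matrix (Fin d) (Fin d) ℝ)
    (t : ℝ) (y : Fin N → Matrix (Fin d) (Fin d) ℝ) : Fin N → Matrix (Fin d) (Fin d) ℝ :=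
  fun i => S i + t • M i + (Γ i - t • BE i)ᵀ * opE Pr y i * (Γ i - t • BE i)

theorem Phi_continuous (Pr : Matrix (Fin N) (Fin N) ℝ)
    (Γ : Fin N → Matrix (Fin d) (Fin d) ℝ) (BE S M : Fin N → Matrix (Fin d) (Fin d) ℝ) :
    Continuous fun q : ℝ × (Fin N → Matrix (Fin d) (Fin d) ℝ) => Phi Pr Γ BE S M q.1 q.2 := by
  unfold Phi opE
  fun_prop

theorem opE_add_smul (Pr : Matrix (Fin N) (Fin N) ℝ) (P y : Fin N → Matrix (Fin d) (Fin d) ℝ)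
    (t : ℝ) (i : Fin N) : opE Pr (P + t • y) i = opE Pr P i + t • opE Pr y i := by
  simp only [opE, Pi.add_apply, Pi.smul_apply, smul_add, Finset.sum_add_distrib, Finset.smul_sum]
  congr 1
  exact Finset.sum_congr rfl fun j _ => smul_comm _ _ _

theorem opE_symm (Pr : Matrix (Fin N) (Fin N) ℝ) (P : Fin N → Matrix (Fin d) (Fin d) ℝ)
    (hP : ∀ i, (P i)ᵀ = P i) (i : Fin N) : (opE Pr P i)ᵀ = opE Pr P i := by
  simp [opE, Matrix.transpose_sum, Matrix.transpose_smul, hP]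

theorem lyap_identity (A : Matrix (Fin d) (Fin d) ℝ) (B : Matrix (Fin d) (Fin k) ℝ)
    (Q G Y P y : Matrix (Fin d) (Fin d) ℝ) (R : Matrix (Fin k) (Fin k) ℝ)
    (K E : Matrix (Fin k) (Fin d) ℝ) (t : ℝ) (ht : t ≠ 0)
    (hR : Rᵀ = R) (hG : Gᵀ = G)
    (h1 : P = Q + Kᵀ * R * K + (A - B * K)ᵀ * G * (A - B * K))
    (h2 : P + t • y = Q + (K + t • E)ᵀ * R * (K + t • E)
      + (A - B * (K + t • E))ᵀ * (G + t • Y) * (A - B * (K + t • E))) :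
    y = (Eᵀ * ((R + Bᵀ * G * B) * K - Bᵀ * G * A) + ((R + Bᵀ * G * B) * K - Bᵀ * G * A)ᵀ * E)
      + t • (Eᵀ * (R + Bᵀ * G * B) * E)
      + ((A - B * K) - t • (B * E))ᵀ * Y * ((A - B * K) - t • (B * E)) := by
  have h3 : t • y = t • ((Eᵀ * ((R + Bᵀ * G * B) * K - Bᵀ * G * A)
      + ((R + Bᵀ * G * B) * K - Bᵀ * G * A)ᵀ * E)
      + t • (Eᵀ * (R + Bᵀ * G * B) * E)
      + ((A - B * K) - t • (B * E))ᵀ * Y * ((A - B * K) - t • (B * E))) := by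
    rw [← eq_sub_iff_add_eq'] at h2
    rw [h2]
    conv_lhs => rw [h1]
    simp only [Matrix.transpose_add, Matrix.transpose_sub, Matrix.transpose_mul,
      Matrix.transpose_smul, Matrix.transpose_transpose, hR, hG, Matrix.mul_add, Matrix.add_mul,
      Matrix.mul_sub, Matrix.sub_mul, Matrix.mul_smul, Matrix.smul_mul, Matrix.mul_assoc,
      smul_add, smul_sub]
    module
  exact smul_right_injective _ ht h3

theorem deriv_PK_eq (Pr : Matrix (Fin N) (Fin N) ℝ)
    (A : Fin N → Matrix (Fin d) (Fin d) ℝ) (B : Fin N → Matrix (Fin d) (Fin k) ℝ)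
    (Q : Fin N → Matrix (Fin d) (Fin d) ℝ) (R : Fin N → Matrix (Fin k) (Fin k) ℝ)
    (hQ : ∀ i, (Q i)ᵀ = Q i) (hR : ∀ i, (R i)ᵀ = R i)
    (K : Fin N → Matrix (Fin k) (Fin d) ℝ) (h : IsUnit (1 - opLK Pr A B K))
    (E : Fin N → Matrix (Fin k) (Fin d) ℝ) (D : Fin N → Matrix (Fin d) (Fin d) ℝ)
    (hline : Tendsto (fun t : ℝ => t⁻¹ • (PK Pr A B Q R (K + t • E) - PK Pr A B Q R K))
      (𝓝[≠] 0) (𝓝 D)) :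
    D = (fun i => (E i)ᵀ * LK Pr A B Q R K i + (LK Pr A B Q R K i)ᵀ * E i)
      + opL Pr (Gam A B K) D := by
  set P := PK Pr A B Q R K with hP
  set M : Fin N → Matrix (Fin d) (Fin d) ℝ :=
    fun i => (E i)ᵀ * (R i + (B i)ᵀ * opE Pr P i * B i) * E i
  set S : Fin N → Matrix (Fin d) (Fin d) ℝ :=
    fun i => (E i)ᵀ * LK Pr A B Q R K i + (LK Pr A B Q R K i)ᵀ * E i with hS
  set BE : Fin N → Matrix (Fin d) (Fin d) ℝ := fun i => B i * E i
  have ht0 : Tendsto (fun t : ℝ => t) (𝓝[≠] 0) (𝓝 0) := tendsto_id.mono_left nhdsWithin_le_nhds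
  have hPhi : Tendsto (fun t : ℝ => Phi Pr (Gam A B K) BE S M t
      (t⁻¹ • (PK Pr A B Q R (K + t • E) - P))) (𝓝[≠] 0)
      (𝓝 (Phi Pr (Gam A B K) BE S M 0 D)) :=
    ((Phi_continuous Pr (Gam A B K) BE S M).tendsto (0, D)).comp (ht0.prodMk_nhds hline)
  have hKt : Tendsto (fun t : ℝ => K + t • E) (𝓝[≠] 0) (𝓝 K) := by
    have hc : Continuous fun t : ℝ => K + t • E := by fun_prop
    have := hc.tendsto 0
    rw [zero_smul, add_zero] at this
    exact this.mono_left nhdsWithin_le_nhds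
  have hev : (fun t : ℝ => t⁻¹ • (PK Pr A B Q R (K + t • E) - P)) =ᶠ[𝓝[≠] 0]
      fun t : ℝ => Phi Pr (Gam A B K) BE S M t (t⁻¹ • (PK Pr A B Q R (K + t • E) - P)) := by
    filter_upwards [hKt.eventually (eventually_isUnit Pr A B K h), self_mem_nhdsWithin] with t hu ht
    have ht' : t ≠ 0 := ht
    set y := t⁻¹ • (PK Pr A B Q R (K + t • E) - P) with hy
    have hPy : PK Pr A B Q R (K + t • E) = P + t • y := by
      rw [hy, smul_inv_smul₀ ht', add_sub_cancel]
    have hL := PK_isLyap Pr A B Q R (K + t • E) hu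
    rw [hPy] at hL
    have hL0 := PK_isLyap Pr A B Q R K h
    funext i
    have e2 := hL i
    rw [opE_add_smul] at e2
    exact lyap_identity (A i) (B i) (Q i) (opE Pr P i) (opE Pr y i) (P i) (y i) (R i) (K i) (E i)
      t ht' (hR i) (opE_symm Pr P (PK_symm Pr A B Q R hQ hR K h) i) (hL0 i) e2
  have := tendsto_nhds_unique (hline.congr' hev) hPhi
  rw [this]
  conv_rhs => rw [← this]
  funext i
  simp [Phi, opL]

theorem ip_add_left {a b : ℕ} (U V S : Fin N → Matrix (Fin a) (Fin b) ℝ) :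
    ip (U + V) S = ip U S + ip V S := by
  simp [ip, Matrix.transpose_add, Matrix.add_mul, Finset.sum_add_distrib]

theorem ip_add_right {a b : ℕ} (U V S : Fin N → Matrix (Fin a) (Fin b) ℝ) :
    ip S (U + V) = ip S U + ip S V := by
  simp [ip, Matrix.mul_add, Finset.sum_add_distrib]

theorem trace_identity (X : Matrix (Fin d) (Fin d) ℝ) (hX : Xᵀ = X)
    (L E : Matrix (Fin k) (Fin d) ℝ) :
    (Xᵀ * (Eᵀ * L + Lᵀ * E)).trace = (((2 : ℝ) • (L * X))ᵀ * E).trace := by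
  have h1 : (X * (Eᵀ * L)).trace = (X * (Lᵀ * E)).trace := by
    rw [← Matrix.trace_transpose]
    simp only [Matrix.transpose_mul, Matrix.transpose_transpose, hX]
    rw [Matrix.trace_mul_comm]
  rw [hX, Matrix.mul_add, Matrix.trace_add, h1, Matrix.transpose_smul, Matrix.transpose_mul, hX,
    Matrix.smul_mul, Matrix.trace_smul, Matrix.mul_assoc, smul_eq_mul, two_mul]

/-- The linear functional, as a plain function. -/
def costF (piv : Fin N → ℝ) (Sg : Matrix (Fin d) (Fin d) ℝ)
    (V : Fin N → Matrix (Fin d) (Fin d) ℝ) : ℝ := ∑ i, piv i * (V i * Sg).trace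

theorem costF_add (piv : Fin N → ℝ) (Sg : Matrix (Fin d) (Fin d) ℝ)
    (V S : Fin N → Matrix (Fin d) (Fin d) ℝ) :
    costF piv Sg (V + S) = costF piv Sg V + costF piv Sg S := by
  simp [costF, Matrix.add_mul, mul_add, Finset.sum_add_distrib]

theorem costF_smul (piv : Fin N → ℝ) (Sg : Matrix (Fin d) (Fin d) ℝ)
    (c : ℝ) (V : Fin N → Matrix (Fin d) (Fin d) ℝ) :
    costF piv Sg (c • V) = c • costF piv Sg V := by
  simp only [costF, Pi.smul_apply, Matrix.smul_mul, Matrix.trace_smul, smul_eq_mul,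
    Finset.mul_sum]
  exact Finset.sum_congr rfl fun i _ => by ring

/-- The linear functional `V ↦ ∑ i, π i tr(V i Sg)`. -/
noncomputable def costLin (piv : Fin N → ℝ) (Sg : Matrix (Fin d) (Fin d) ℝ) :
    Tup d d N →L[ℝ] ℝ :=
  LinearMap.toContinuousLinearMap
    { toFun := fun V : Tup d d N => costF piv Sg V
      map_add' := costF_add piv Sg
      map_smul' := costF_smul piv Sg }

theorem costLin_eq_ip (piv : Fin N → ℝ) (Sg : Matrix (Fin d) (Fin d) ℝ) (hS : Sgᵀ = Sg)
    (V : Fin N → Matrix (Fin d) (Fin d) ℝ) :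
    costLin piv Sg V = ip (fun i => piv i • Sg) V := by
  change ∑ i, piv i * (V i * Sg).trace = _
  simp only [ip, Matrix.transpose_smul, hS, Matrix.smul_mul, Matrix.trace_smul, smul_eq_mul]
  exact Finset.sum_congr rfl fun i _ => by rw [Matrix.trace_mul_comm]

theorem final_ip (Pr : Matrix (Fin N) (Fin N) ℝ) (piv : Fin N → ℝ)
    (Sg : Matrix (Fin d) (Fin d) ℝ) (hSg : Sgᵀ = Sg) (Γ : Fin N → Matrix (Fin d) (Fin d) ℝ)
    (hK : spectralRadius ℂ ((calA Pr Γ).map (algebraMap ℝ ℂ)) < 1)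
    (L E : Fin N → Matrix (Fin k) (Fin d) ℝ) (D : Fin N → Matrix (Fin d) (Fin d) ℝ)
    (hDeq : D = (fun i => (E i)ᵀ * L i + (L i)ᵀ * E i) + opL Pr Γ D) :
    ip (fun i => piv i • Sg) D = ip (fun i => (2 : ℝ) • (L i * XK Pr piv Sg Γ i)) E := by
  set X := XK Pr piv Sg Γ with hX
  have hXs : ∀ i, (X i)ᵀ = X i := XK_symm Pr Γ hK piv Sg (hSg)
  have e1 : ip X D = ip (fun i => piv i • Sg) D + ip X (opL Pr Γ D) := by
    rw [← ip_opT, ← ip_add_left, ← XK_eq Pr Γ hK]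
  have e2 := congrArg (ip X) hDeq
  rw [ip_add_right] at e2
  have e3 : ip (fun i => piv i • Sg) D
      = ip X (fun i => (E i)ᵀ * L i + (L i)ᵀ * E i) := by
    linarith
  rw [e3]
  exact Finset.sum_congr rfl fun i _ => trace_identity (X i) (hXs i) _ _

theorem cost_aux
    (d k N : ℕ) (hd : 0 < d) (hk : 0 < k) (hN : 0 < N)
    (A : Fin N → Matrix (Fin d) (Fin d) ℝ) (B : Fin N → Matrix (Fin d) (Fin k) ℝ)
    (Pr : Matrix (Fin N) (Fin N) ℝ)
    (hPr : ∀ i j, 0 ≤ Pr i j) (hPrSum : ∀ i, ∑ j, Pr i j = 1)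
    (piv : Fin N → ℝ) (hpiv : ∀ i, 0 < piv i) (hpivSum : ∑ i, piv i = 1)
    (Sg : Matrix (Fin d) (Fin d) ℝ) (hSg : Sg.PosDef)
    (Q : Fin N → Matrix (Fin d) (Fin d) ℝ) (hQ : ∀ i, (Q i).PosDef)
    (R : Fin N → Matrix (Fin k) (Fin k) ℝ) (hR : ∀ i, (R i).PosDef)
    (K : Tup k d N) (hK : MSS Pr A B K) :
    ContDiffAt ℝ 1 (fun K' : Tup k d N => cost Pr A B Q R piv Sg K') (K : Tup k d N) ∧
    ∀ E : Tup k d N,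
      fderiv ℝ (fun K' : Tup k d N => cost Pr A B Q R piv Sg K') (K : Tup k d N) E
        = ip (fun i => (2 : ℝ) • (LK Pr A B Q R K i * XK Pr piv Sg (Gam A B K) i)) E := by
  have hsym : ∀ {m : ℕ} {M : Matrix (Fin m) (Fin m) ℝ}, M.PosDef → Mᵀ = M := by
    intro m M hM
    have := hM.isHermitian.eq
    rwa [Matrix.conjTranspose_eq_transpose_of_trivial] at this
  have hu : IsUnit (1 - opLK Pr A B K) := isUnit_of_MSS Pr (Gam A B K) hK
  have hPK := contDiffAt_PK Pr A B Q R K hu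
  refine ⟨?_, fun E => ?_⟩
  · change ContDiffAt ℝ 1 (fun K' : Tup k d N => costLin piv Sg (PKt Pr A B Q R K')) K
    exact (costLin piv Sg).contDiff.contDiffAt.comp K hPK
  · have hdiff := (hPK.differentiableAt one_ne_zero).hasFDerivAt
    have hline := (hdiff.hasLineDerivAt E).tendsto_slope_zero
    have hf : fderiv ℝ (fun K' : Tup k d N => cost Pr A B Q R piv Sg K') K E
        = costLin piv Sg (fderiv ℝ (PKt Pr A B Q R) K E) := by
      have := ((costLin piv Sg).hasFDerivAt.comp (K : Tup k d N) hdiff).fderiv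
      exact congrArg (fun f => f E) this
    refine hf.trans ((costLin_eq_ip piv Sg (hsym hSg) _).trans ?_)
    generalize fderiv ℝ (PKt Pr A B Q R) K E = D at *
    have hDeq := deriv_PK_eq Pr A B Q R (fun i => hsym (hQ i)) (fun i => hsym (hR i)) K hu E D hline
    exact final_ip Pr piv Sg (hsym hSg) (Gam A B K) hK (LK Pr A B Q R K) E D hDeq

end main

attribute [local instance] Matrix.normedAddCommGroup Matrix.normedSpace

/-- differentiability of the cost and the policy gradient formula
`∇C(K)_i = 2 L^K_i 𝐗^K_i`, the gradient being represented via the inner product. -/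
theorem cost_contDiffAt_and_gradient_formula
    (d k N : ℕ) (hd : 0 < d) (hk : 0 < k) (hN : 0 < N)
    (A : Fin N → Matrix (Fin d) (Fin d) ℝ) (B : Fin N → Matrix (Fin d) (Fin k) ℝ)
    (Pr : Matrix (Fin N) (Fin N) ℝ)
    (hPr : ∀ i j, 0 ≤ Pr i j) (hPrSum : ∀ i, ∑ j, Pr i j = 1)
    (piv : Fin N → ℝ) (hpiv : ∀ i, 0 < piv i) (hpivSum : ∑ i, piv i = 1)
    (Sg : Matrix (Fin d) (Fin d) ℝ) (hSg : Sg.PosDef)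
    (Q : Fin N → Matrix (Fin d) (Fin d) ℝ) (hQ : ∀ i, (Q i).PosDef)
    (R : Fin N → Matrix (Fin k) (Fin k) ℝ) (hR : ∀ i, (R i).PosDef)
    (K : Fin N → Matrix (Fin k) (Fin d) ℝ) (hK : MSS Pr A B K) :
    ContDiffAt ℝ 1 (cost Pr A B Q R piv Sg) K ∧
    ∀ E : Fin N → Matrix (Fin k) (Fin d) ℝ,
      fderiv ℝ (cost Pr A B Q R piv Sg) K E
        = ip (fun i => (2 : ℝ) • (LK Pr A B Q R K i * XK Pr piv Sg (Gam A B K) i)) E := by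
  exact cost_aux d k N hd hk hN A B Pr hPr hPrSum piv hpiv hpivSum Sg hSg Q hQ R hR K hK

end MJLS
end

section
/- (Coercivity, boundary part.) Let {K^l} ⊂ 𝕂 be a sequence of mean-square stabilizing policies converging to a policy K lying on the boundary of 𝕂, i.e., the spectral radius of the matrix 𝒜 associated with K equals 1. Then C(K^l) → +∞ as l → ∞. -/
open Matrix Filter
open scoped Kronecker Topology

namespace MJLS

noncomputable section

attribute [local instance] Classical.propDecidable

end

section Helpers

attribute [local instance] Matrix.linftyOpNormedRing Matrix.linftyOpNormedAlgebra

/-- powers of a complex matrix of spectral radius less than one tend to zero -/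
lemma cpow_tendsto_zero {n : Type*} [Fintype n] [DecidableEq n] (M : Matrix n n ℂ)
    (h : spectralRadius ℂ M < 1) : Tendsto (fun t : ℕ => M ^ t) atTop (𝓝 0) := by
  have : CompleteSpace (Matrix n n ℂ) := FiniteDimensional.complete ℂ _
  obtain ⟨r, hr1, hr2⟩ := ENNReal.lt_iff_exists_nnreal_btwn.mp h
  have hr2' : r < 1 := by exact_mod_cast hr2
  have hG := spectrum.pow_nnnorm_pow_one_div_tendsto_nhds_spectralRadius M
  have hev := hG.eventually_lt_const hr1
  refine tendsto_zero_iff_norm_tendsto_zero.mpr ?_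
  have hpow : Tendsto (fun t : ℕ => (r : ℝ) ^ t) atTop (𝓝 0) :=
    tendsto_pow_atTop_nhds_zero_of_lt_one r.2 (by exact_mod_cast hr2')
  refine squeeze_zero' (Eventually.of_forall fun _ => norm_nonneg _) ?_ hpow
  filter_upwards [hev, eventually_gt_atTop 0] with t ht htpos
  have htp : (0 : ℝ) < t := by exact_mod_cast htpos
  rw [one_div, ENNReal.rpow_inv_lt_iff htp, ENNReal.rpow_natCast] at ht
  have : ‖M ^ t‖₊ < r ^ t := by exact_mod_cast ht
  have := this.le
  exact_mod_cast this

lemma spectralRadius_lt_of_tendsto {n : Type*} [Fintype n] [DecidableEq n] [Nonempty n]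
    (M : Matrix n n ℂ)
    (h : Tendsto (fun t : ℕ => M ^ t) atTop (𝓝 0)) : spectralRadius ℂ M < 1 := by
  have : CompleteSpace (Matrix n n ℂ) := FiniteDimensional.complete ℂ _
  replace h := tendsto_zero_iff_norm_tendsto_zero.mp h
  obtain ⟨t, ht, htpos⟩ := ((h.eventually_lt_const one_pos).and (eventually_gt_atTop 0)).exists
  obtain ⟨m, rfl⟩ : ∃ m, t = m + 1 := ⟨t - 1, by omega⟩
  refine (spectrum.spectralRadius_le_pow_nnnorm_pow_one_div ℂ M m).trans_lt ?_
  have h1 : ‖(1 : Matrix n n ℂ)‖₊ = 1 := nnnorm_one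
  rw [h1]
  simp only [ENNReal.coe_one, ENNReal.one_rpow, mul_one]
  apply ENNReal.rpow_lt_one
  · exact_mod_cast ht
  · positivity

end Helpers

lemma iterate_mulVec {n : Type*} [Fintype n] [DecidableEq n] (M : Matrix n n ℝ) (t : ℕ)
    (v : n → ℝ) : (M.mulVec)^[t] v = (M ^ t) *ᵥ v := by
  induction t with
  | zero => simp
  | succ t ih => rw [Function.iterate_succ_apply', ih, pow_succ', Matrix.mulVec_mulVec]

lemma iter_of_radius {n : Type*} [Fintype n] [DecidableEq n] (M : Matrix n n ℝ)
    (h : spectralRadius ℂ (M.map (algebraMap ℝ ℂ)) < 1) (v : n → ℝ) :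
    Tendsto (fun t => (M.mulVec)^[t] v) atTop (𝓝 0) := by
  have h1 := cpow_tendsto_zero _ h
  have h2 : ∀ t : ℕ, (M.map (algebraMap ℝ ℂ)) ^ t = (M ^ t).map (algebraMap ℝ ℂ) := by
    intro t
    exact (map_pow (RingHom.mapMatrix (algebraMap ℝ ℂ)) M t).symm
  have h3 : Tendsto (fun t : ℕ => M ^ t) atTop (𝓝 0) := by
    have hc : Continuous fun X : Matrix n n ℂ => X.map Complex.re :=
      continuous_id.matrix_map Complex.continuous_re
    have := (hc.tendsto 0).comp h1
    convert! this using 1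
    · funext t
      ext i j
      simp only [Function.comp, h2]
      exact (Complex.ofReal_re _).symm
  have hc : Continuous fun X : Matrix n n ℝ => X *ᵥ v :=
    continuous_id.matrix_mulVec continuous_const
  have := (hc.tendsto 0).comp h3
  simpa [Function.comp_def, iterate_mulVec] using this

lemma radius_of_iter {n : Type*} [Fintype n] [DecidableEq n] [Nonempty n] (M : Matrix n n ℝ)
    (h : ∀ v : n → ℝ, Tendsto (fun t => (M.mulVec)^[t] v) atTop (𝓝 0)) :
    spectralRadius ℂ (M.map (algebraMap ℝ ℂ)) < 1 := by
  apply spectralRadius_lt_of_tendsto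
  have h2 : ∀ t : ℕ, (M.map (algebraMap ℝ ℂ)) ^ t = (M ^ t).map (algebraMap ℝ ℂ) := by
    intro t
    exact (map_pow (RingHom.mapMatrix (algebraMap ℝ ℂ)) M t).symm
  simp_rw [h2]
  refine tendsto_pi_nhds.mpr fun i => tendsto_pi_nhds.mpr fun j => ?_
  have h3 := (tendsto_pi_nhds.mp (h (Pi.single j 1))) i
  simp only [iterate_mulVec, Matrix.mulVec_single_one, Matrix.col_apply, Pi.zero_apply] at h3
  have := (Complex.continuous_ofReal.tendsto 0).comp h3
  simpa [Function.comp_def] using this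

/-- vectorization -/
def vecz {d N : ℕ} (V : Fin N → Matrix (Fin d) (Fin d) ℝ) : Fin N × Fin d × Fin d → ℝ :=
  fun x => V x.1 x.2.1 x.2.2

lemma calA_mulVec {d N : ℕ} (Pr : Matrix (Fin N) (Fin N) ℝ)
    (Γ : Fin N → Matrix (Fin d) (Fin d) ℝ) (V : Fin N → Matrix (Fin d) (Fin d) ℝ) :
    (calA Pr Γ) *ᵥ vecz V = vecz (opL Pr Γ V) := by
  unfold calA
  rw [← Matrix.mulVec_mulVec]
  have h1 : (Pr ⊗ₖ (1 : Matrix (Fin d × Fin d) (Fin d × Fin d) ℝ)) *ᵥ vecz V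
      = vecz (opE Pr V) := by
    funext ⟨i, a, b⟩
    simp [Matrix.mulVec, dotProduct, vecz, opE, Fintype.sum_prod_type, Matrix.sum_apply,
      Matrix.one_apply]
  rw [h1]
  have h2 : opL Pr Γ V = fun i => (Γ i)ᵀ * opE Pr V i * Γ i := rfl
  rw [h2]
  generalize opE Pr V = W
  funext ⟨i, a, b⟩
  simp only [Matrix.mulVec, dotProduct, vecz, opL, Fintype.sum_prod_type, Matrix.reindex_apply,
    Matrix.submatrix_apply, Matrix.blockDiagonal_apply, Matrix.mul_apply]
  simp only [Equiv.prodComm_symm, Equiv.prodComm_apply, Prod.swap_prod_mk, Matrix.kroneckerMap_apply,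
    Matrix.transpose_apply, ite_mul, zero_mul]
  rw [Finset.sum_eq_single i]
  · simp only [if_true, Finset.sum_mul]
    rw [Finset.sum_comm]
    exact Finset.sum_congr rfl fun x _ => Finset.sum_congr rfl fun y _ => by ring
  · intro j _ hj
    simp [hj.symm]
  · simp

lemma vecz_iter {d N : ℕ} (Pr : Matrix (Fin N) (Fin N) ℝ)
    (Γ : Fin N → Matrix (Fin d) (Fin d) ℝ) (V : Fin N → Matrix (Fin d) (Fin d) ℝ) (t : ℕ) :
    ((calA Pr Γ).mulVec)^[t] (vecz V) = vecz ((opL Pr Γ)^[t] V) := by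
  induction t with
  | zero => rfl
  | succ t ih => rw [Function.iterate_succ_apply', ih, calA_mulVec, Function.iterate_succ_apply']

/-- all trajectories of `opL` tend to zero -/
def Stab {d N : ℕ} (Pr : Matrix (Fin N) (Fin N) ℝ)
    (Γ : Fin N → Matrix (Fin d) (Fin d) ℝ) : Prop :=
  ∀ V, Tendsto (fun t => (opL Pr Γ)^[t] V) atTop (𝓝 0)

lemma stab_of_radius {d N : ℕ} (Pr : Matrix (Fin N) (Fin N) ℝ)
    (Γ : Fin N → Matrix (Fin d) (Fin d) ℝ)
    (h : ∀ v, Tendsto (fun t => ((calA Pr Γ).mulVec)^[t] v) atTop (𝓝 0)) : Stab Pr Γ := by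
  intro V
  have := h (vecz V)
  simp only [vecz_iter] at this
  refine tendsto_pi_nhds.mpr fun i => tendsto_pi_nhds.mpr fun a => tendsto_pi_nhds.mpr fun b => ?_
  exact (tendsto_pi_nhds.mp this) (i, a, b)

lemma radius_of_stab {d N : ℕ} (Pr : Matrix (Fin N) (Fin N) ℝ)
    (Γ : Fin N → Matrix (Fin d) (Fin d) ℝ) (h : Stab Pr Γ) :
    ∀ v, Tendsto (fun t => ((calA Pr Γ).mulVec)^[t] v) atTop (𝓝 0) := by
  intro v
  have hv : v = vecz (fun i => Matrix.of fun a b => v (i, a, b)) := rfl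
  rw [hv]
  simp only [vecz_iter]
  refine tendsto_pi_nhds.mpr fun ⟨i, a, b⟩ => ?_
  have h1 := tendsto_pi_nhds.mp (h (fun i => Matrix.of fun a b => v (i, a, b))) i
  exact tendsto_pi_nhds.mp (tendsto_pi_nhds.mp h1 a) b

/-- `opL` as a linear map -/
def opLin {d N : ℕ} (Pr : Matrix (Fin N) (Fin N) ℝ) (Γ : Fin N → Matrix (Fin d) (Fin d) ℝ) :
    (Fin N → Matrix (Fin d) (Fin d) ℝ) →ₗ[ℝ] (Fin N → Matrix (Fin d) (Fin d) ℝ) where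
  toFun := opL Pr Γ
  map_add' V W := by
    funext i
    simp [opL, opE, Finset.sum_add_distrib, mul_add, add_mul]
  map_smul' c V := by
    funext i
    simp only [opL, opE, Pi.smul_apply, smul_comm _ c, ← Finset.smul_sum, RingHom.id_apply,
      Matrix.mul_smul, Matrix.smul_mul]

lemma exists_fix {d N : ℕ} (Pr : Matrix (Fin N) (Fin N) ℝ)
    (Γ : Fin N → Matrix (Fin d) (Fin d) ℝ) (h : Stab Pr Γ)
    (S : Fin N → Matrix (Fin d) (Fin d) ℝ) : ∃ P, P = S + opL Pr Γ P := by
  have hinj : Function.Injective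
      (LinearMap.id - opLin Pr Γ : (Fin N → Matrix (Fin d) (Fin d) ℝ) →ₗ[ℝ]
        (Fin N → Matrix (Fin d) (Fin d) ℝ)) := by
    rw [← LinearMap.ker_eq_bot, LinearMap.ker_eq_bot']
    intro m hm
    have h1 : opL Pr Γ m = m := by
      have : m - opL Pr Γ m = 0 := hm
      exact (sub_eq_zero.mp this).symm
    have h2 : ∀ t, (opL Pr Γ)^[t] m = m := fun t => Function.iterate_fixed h1 t
    have h3 := h m
    simp only [h2] at h3
    exact tendsto_nhds_unique tendsto_const_nhds h3
  obtain ⟨P, hP⟩ := LinearMap.injective_iff_surjective.mp hinj S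
  refine ⟨P, ?_⟩
  have : P - opL Pr Γ P = S := hP
  rw [← this]; abel

lemma posSemidef_of_tendsto {d : ℕ} (u : ℕ → Matrix (Fin d) (Fin d) ℝ)
    (M : Matrix (Fin d) (Fin d) ℝ) (hu : ∀ n, (u n).PosSemidef)
    (h : Tendsto u atTop (𝓝 M)) : M.PosSemidef := by
  refine Matrix.PosSemidef.of_dotProduct_mulVec_nonneg ?_ fun x => ?_
  · have hc : Continuous fun X : Matrix (Fin d) (Fin d) ℝ => Xᴴ :=
      continuous_id.matrix_conjTranspose
    have h1 := (hc.tendsto M).comp h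
    have h2 : (fun X : Matrix (Fin d) (Fin d) ℝ => Xᴴ) ∘ u = u := by
      funext n
      exact (hu n).1
    rw [h2] at h1
    exact tendsto_nhds_unique h1 h
  · have hc : Continuous fun X : Matrix (Fin d) (Fin d) ℝ => star x ⬝ᵥ (X *ᵥ x) :=
      continuous_const.dotProduct (continuous_id.matrix_mulVec continuous_const)
    exact ge_of_tendsto' ((hc.tendsto M).comp h) fun n => (hu n).dotProduct_mulVec_nonneg x

lemma opL_psd {d N : ℕ} (Pr : Matrix (Fin N) (Fin N) ℝ) (hPr : ∀ i j, 0 ≤ Pr i j)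
    (Γ : Fin N → Matrix (Fin d) (Fin d) ℝ) (V : Fin N → Matrix (Fin d) (Fin d) ℝ)
    (hV : ∀ i, (V i).PosSemidef) (i : Fin N) : (opL Pr Γ V i).PosSemidef := by
  have h1 : (opE Pr V i).PosSemidef :=
    Matrix.posSemidef_sum _ fun j _ => (hV j).smul (hPr i j)
  simpa [opL] using h1.conjTranspose_mul_mul_same (Γ i)

lemma fix_psd {d N : ℕ} (Pr : Matrix (Fin N) (Fin N) ℝ) (hPr : ∀ i j, 0 ≤ Pr i j)
    (Γ : Fin N → Matrix (Fin d) (Fin d) ℝ) (h : Stab Pr Γ)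
    (S P : Fin N → Matrix (Fin d) (Fin d) ℝ) (hS : ∀ i, (S i).PosSemidef)
    (hP : P = S + opL Pr Γ P) (i : Fin N) : (P i).PosSemidef := by
  have hit : ∀ t i, ((opL Pr Γ)^[t] S i).PosSemidef := by
    intro t
    induction t with
    | zero => exact hS
    | succ t ih => rw [Function.iterate_succ_apply']; exact opL_psd Pr hPr Γ _ ih
  have hsum : ∀ n : ℕ, ∑ t ∈ Finset.range n, (opL Pr Γ)^[t] S = P - (opL Pr Γ)^[n] P := by
    intro n
    induction n with
    | zero => simp
    | succ n ih =>
      rw [Finset.sum_range_succ, ih]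
      have h1 : (opL Pr Γ)^[n] P = (opL Pr Γ)^[n] S + (opL Pr Γ)^[n+1] P := by
        have h2 : ∀ V W, (opL Pr Γ)^[n] (V + W) = (opL Pr Γ)^[n] V + (opL Pr Γ)^[n] W := by
          intro V W
          have h3 : (opL Pr Γ)^[n] = ⇑((opLin Pr Γ) ^ n) := by
            rw [Module.End.coe_pow]; rfl
          rw [h3, map_add]
        conv_lhs => rw [hP]
        rw [h2, Function.iterate_succ_apply]
      rw [h1]; abel
  have h1 : Tendsto (fun n : ℕ => P i - (opL Pr Γ)^[n] P i) atTop (𝓝 (P i)) := by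
    have := (tendsto_pi_nhds.mp (h P) i)
    simpa using this.const_sub (P i)
  refine posSemidef_of_tendsto _ _ (fun n => ?_) h1
  have := congrFun (hsum n) i
  rw [Pi.sub_apply] at this
  rw [← this, Finset.sum_apply]
  exact Matrix.posSemidef_sum _ fun t _ => hit t i

lemma bilin_bound {d : ℕ} (M : Matrix (Fin d) (Fin d) ℝ) :
    ∃ C : ℝ, 0 < C ∧ ∀ u v : Fin d → ℝ, |u ⬝ᵥ (M *ᵥ v)| ≤ C * (u ⬝ᵥ u + v ⬝ᵥ v) := by
  refine ⟨1 + ∑ a, ∑ b, |M a b|, by positivity, fun u v => ?_⟩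
  have hsq : ∀ (w : Fin d → ℝ) a, w a ^ 2 ≤ w ⬝ᵥ w := fun w a => by
    have := Finset.single_le_sum (f := fun a => w a * w a) (fun a _ => mul_self_nonneg (w a))
      (Finset.mem_univ a)
    simpa [dotProduct, sq] using this
  have hu0 : 0 ≤ u ⬝ᵥ u := Finset.sum_nonneg fun a _ => mul_self_nonneg (u a)
  have hv0 : 0 ≤ v ⬝ᵥ v := Finset.sum_nonneg fun a _ => mul_self_nonneg (v a)
  have h1 : |u ⬝ᵥ (M *ᵥ v)| ≤ ∑ a, ∑ b, |M a b| * (u ⬝ᵥ u + v ⬝ᵥ v) := by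
    simp only [dotProduct, Matrix.mulVec, Finset.mul_sum]
    refine (Finset.abs_sum_le_sum_abs _ _).trans (Finset.sum_le_sum fun a _ => ?_)
    refine (Finset.abs_sum_le_sum_abs _ _).trans (Finset.sum_le_sum fun b _ => ?_)
    have e : |u a * (M a b * v b)| = |M a b| * (|u a| * |v b|) := by
      rw [abs_mul, abs_mul]; ring
    rw [e]
    refine mul_le_mul_of_nonneg_left ?_ (abs_nonneg _)
    have := hsq u a
    have := hsq v b
    simp only [dotProduct] at *
    nlinarith [sq_nonneg (|u a| - |v b|), sq_abs (u a), sq_abs (v b), sq_nonneg (u a), sq_nonneg (v b)]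
  simp only [← Finset.sum_mul] at h1
  nlinarith

lemma posDef_bound {d : ℕ} (M : Matrix (Fin d) (Fin d) ℝ) (hM : M.PosDef) :
    ∃ c : ℝ, 0 < c ∧ ∀ u : Fin d → ℝ, c * (u ⬝ᵥ u) ≤ u ⬝ᵥ (M *ᵥ u) := by
  have hpos : ∀ u : Fin d → ℝ, u ≠ 0 → 0 < u ⬝ᵥ (M *ᵥ u) := fun u hu => by
    simpa using hM.dotProduct_mulVec_pos hu
  have hself : ∀ u : Fin d → ℝ, u ≠ 0 → 0 < u ⬝ᵥ u := fun u hu => by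
    have h0 : 0 ≤ u ⬝ᵥ u := Finset.sum_nonneg fun a _ => mul_self_nonneg (u a)
    exact lt_of_le_of_ne h0 fun h => hu (dotProduct_self_eq_zero.mp h.symm)
  rcases (Metric.sphere (0 : Fin d → ℝ) 1).eq_empty_or_nonempty with he | hne
  · refine ⟨1, one_pos, fun u => ?_⟩
    have hu : u = 0 := by
      by_contra hu
      have : (‖u‖⁻¹ • u) ∈ Metric.sphere (0 : Fin d → ℝ) 1 := by
        simp [norm_smul, norm_ne_zero_iff.mpr hu]
      rw [he] at this
      exact this
    simp [hu]
  · have hcont : ContinuousOn (fun u : Fin d → ℝ => (u ⬝ᵥ (M *ᵥ u)) / (u ⬝ᵥ u))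
        (Metric.sphere 0 1) := by
      refine ContinuousOn.div ?_ ?_ ?_
      · exact (continuous_id.dotProduct (continuous_const.matrix_mulVec continuous_id)).continuousOn
      · exact (continuous_id.dotProduct continuous_id).continuousOn
      · intro u hu
        have : u ≠ 0 := by rintro rfl; simp at hu
        exact (hself u this).ne'
    obtain ⟨w, hw, hmin⟩ := (isCompact_sphere (0 : Fin d → ℝ) 1).exists_isMinOn hne hcont
    have hw0 : w ≠ 0 := by rintro rfl; simp at hw
    refine ⟨(w ⬝ᵥ (M *ᵥ w)) / (w ⬝ᵥ w), div_pos (hpos w hw0) (hself w hw0), fun u => ?_⟩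
    by_cases hu : u = 0
    · simp [hu]
    · have hmem : (‖u‖⁻¹ • u) ∈ Metric.sphere (0 : Fin d → ℝ) 1 := by
        simp [norm_smul, norm_ne_zero_iff.mpr hu]
      have h1 := hmin hmem
      have hn : ‖u‖ ≠ 0 := norm_ne_zero_iff.mpr hu
      have e : ((‖u‖⁻¹ • u) ⬝ᵥ (M *ᵥ (‖u‖⁻¹ • u))) / ((‖u‖⁻¹ • u) ⬝ᵥ (‖u‖⁻¹ • u))
          = (u ⬝ᵥ (M *ᵥ u)) / (u ⬝ᵥ u) := by
        simp only [Matrix.mulVec_smul, smul_dotProduct, dotProduct_smul, smul_eq_mul]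
        have := (hself u hu).ne'
        field_simp
      have h2 : (w ⬝ᵥ (M *ᵥ w)) / (w ⬝ᵥ w) ≤ (u ⬝ᵥ (M *ᵥ u)) / (u ⬝ᵥ u) := by
        rw [← e]; exact h1
      exact (le_div_iff₀ (hself u hu)).mp h2

lemma opL_form {d N : ℕ} (Pr : Matrix (Fin N) (Fin N) ℝ)
    (Γ : Fin N → Matrix (Fin d) (Fin d) ℝ) (V : Fin N → Matrix (Fin d) (Fin d) ℝ) (i : Fin N)
    (u v : Fin d → ℝ) :
    u ⬝ᵥ (opL Pr Γ V i *ᵥ v) = ∑ j, Pr i j * ((Γ i *ᵥ u) ⬝ᵥ (V j *ᵥ (Γ i *ᵥ v))) := by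
  have h1 : u ⬝ᵥ (opL Pr Γ V i *ᵥ v) = (Γ i *ᵥ u) ⬝ᵥ (opE Pr V i *ᵥ (Γ i *ᵥ v)) := by
    simp only [opL, ← Matrix.mulVec_mulVec]
    rw [Matrix.dotProduct_mulVec, Matrix.vecMul_transpose]
  rw [h1]
  generalize Γ i *ᵥ u = x
  generalize Γ i *ᵥ v = y
  simp [opE, Matrix.sum_mulVec, dotProduct_sum, Matrix.smul_mulVec]

/-- Lyapunov: a positive definite strict supersolution forces stability -/
lemma stab_of_lyap {d N : ℕ} (Pr : Matrix (Fin N) (Fin N) ℝ) (hPr : ∀ i j, 0 ≤ Pr i j)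
    (Γ : Fin N → Matrix (Fin d) (Fin d) ℝ)
    (S P : Fin N → Matrix (Fin d) (Fin d) ℝ) (hS : ∀ i, (S i).PosDef)
    (hPpsd : ∀ i, (P i).PosSemidef)
    (hP : P = S + opL Pr Γ P) : Stab Pr Γ := by
  choose c hc0 hc using fun i => posDef_bound (S i) (hS i)
  choose C hC0 hC using fun i => bilin_bound (P i)
  have hself : ∀ u : Fin d → ℝ, 0 ≤ u ⬝ᵥ u := fun u =>
    Finset.sum_nonneg fun a _ => mul_self_nonneg (u a)
  have hLpos : ∀ i u, 0 ≤ u ⬝ᵥ (opL Pr Γ P i *ᵥ u) := fun i u => by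
    simpa using (opL_psd Pr hPr Γ P hPpsd i).dotProduct_mulVec_nonneg u
  have hsplit : ∀ i u, u ⬝ᵥ (P i *ᵥ u) = u ⬝ᵥ (S i *ᵥ u) + u ⬝ᵥ (opL Pr Γ P i *ᵥ u) := by
    intro i u
    conv_lhs => rw [hP]
    rw [Pi.add_apply, Matrix.add_mulVec, dotProduct_add]
  have hPlow : ∀ i u, c i * (u ⬝ᵥ u) ≤ u ⬝ᵥ (P i *ᵥ u) := fun i u => by
    linarith [hsplit i u, hc i u, hLpos i u]
  -- contraction factor
  obtain ⟨r, hr0, hr1, hr⟩ : ∃ r : ℝ, 0 ≤ r ∧ r < 1 ∧ ∀ i u,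
      u ⬝ᵥ (opL Pr Γ P i *ᵥ u) ≤ r * (u ⬝ᵥ (P i *ᵥ u)) := by
    have hε : ∀ i, ∃ ε : ℝ, 0 < ε ∧ ∀ u, ε * (u ⬝ᵥ (P i *ᵥ u)) ≤ u ⬝ᵥ (S i *ᵥ u) := by
      intro i
      refine ⟨c i / (2 * C i), div_pos (hc0 i) (by linarith [hC0 i]), fun u => ?_⟩
      have h1 := (le_abs_self _).trans (hC i u u)
      have h2 := hc i u
      have h3 := hC0 i
      have h4 := hc0 i
      calc c i / (2 * C i) * (u ⬝ᵥ (P i *ᵥ u))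
          ≤ c i / (2 * C i) * (C i * (u ⬝ᵥ u + u ⬝ᵥ u)) :=
            mul_le_mul_of_nonneg_left h1 (by positivity)
        _ = c i * (u ⬝ᵥ u) := by field_simp; ring
        _ ≤ _ := h2
    choose ε hε0 hε using hε
    obtain ⟨e, he0, he1, he⟩ : ∃ e : ℝ, 0 < e ∧ e ≤ 1 ∧ ∀ i, e ≤ ε i := by
      have hfin : (Set.range ε ∪ {1}).Finite := (Set.finite_range ε).union (Set.finite_singleton 1)
      obtain ⟨e, hemem, hemin⟩ := hfin.exists_minimal ⟨1, by simp⟩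
      have hle : ∀ x ∈ Set.range ε ∪ {1}, e ≤ x := fun x hx => by
        rcases le_total e x with h | h
        · exact h
        · exact hemin hx h
      refine ⟨e, ?_, hle 1 (by simp), fun i => hle _ (by simp)⟩
      rcases hemem with ⟨i, rfl⟩ | h
      · exact hε0 i
      · rw [Set.mem_singleton_iff.mp h]; exact one_pos
    refine ⟨1 - e, by linarith, by linarith, fun i u => ?_⟩
    have h1 := hε i u
    have h2 : 0 ≤ u ⬝ᵥ (P i *ᵥ u) := (mul_nonneg (hc0 i).le (hself u)).trans (hPlow i u)
    nlinarith [hsplit i u, he i]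
  intro V
  choose D hD0 hD using fun i => bilin_bound (V i)
  obtain ⟨b, hb0, hb⟩ : ∃ b : ℝ, 0 ≤ b ∧ ∀ i u v,
      |u ⬝ᵥ (V i *ᵥ v)| ≤ b * (u ⬝ᵥ (P i *ᵥ u) + v ⬝ᵥ (P i *ᵥ v)) := by
    refine ⟨∑ i, D i / c i, Finset.sum_nonneg fun i _ => (div_pos (hD0 i) (hc0 i)).le,
      fun i u v => ?_⟩
    have h1 : D i / c i ≤ ∑ i, D i / c i := Finset.single_le_sum (f := fun i => D i / c i)
      (fun i _ => (div_pos (hD0 i) (hc0 i)).le) (Finset.mem_univ i)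
    have h2 : c i * (u ⬝ᵥ u + v ⬝ᵥ v) ≤ u ⬝ᵥ (P i *ᵥ u) + v ⬝ᵥ (P i *ᵥ v) := by
      linarith [hPlow i u, hPlow i v]
    have h3 := hc0 i
    have h4 := hD0 i
    have h5 : 0 ≤ c i * (u ⬝ᵥ u + v ⬝ᵥ v) := mul_nonneg h3.le (add_nonneg (hself u) (hself v))
    calc |u ⬝ᵥ (V i *ᵥ v)| ≤ D i * (u ⬝ᵥ u + v ⬝ᵥ v) := hD i u v
      _ = D i / c i * (c i * (u ⬝ᵥ u + v ⬝ᵥ v)) := by field_simp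
      _ ≤ D i / c i * (u ⬝ᵥ (P i *ᵥ u) + v ⬝ᵥ (P i *ᵥ v)) :=
          mul_le_mul_of_nonneg_left h2 (by positivity)
      _ ≤ _ := mul_le_mul_of_nonneg_right h1 (h5.trans h2)
  have key : ∀ t i u v, |u ⬝ᵥ ((opL Pr Γ)^[t] V i *ᵥ v)| ≤
      (b * r ^ t) * (u ⬝ᵥ (P i *ᵥ u) + v ⬝ᵥ (P i *ᵥ v)) := by
    intro t
    induction t with
    | zero => simpa using hb
    | succ t ih =>
      intro i u v
      rw [Function.iterate_succ_apply', opL_form]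
      have hbr : 0 ≤ b * r ^ t := by positivity
      calc |∑ j, Pr i j * ((Γ i *ᵥ u) ⬝ᵥ ((opL Pr Γ)^[t] V j *ᵥ (Γ i *ᵥ v)))|
          ≤ ∑ j, Pr i j * ((b * r ^ t) * ((Γ i *ᵥ u) ⬝ᵥ (P j *ᵥ (Γ i *ᵥ u))
              + (Γ i *ᵥ v) ⬝ᵥ (P j *ᵥ (Γ i *ᵥ v)))) := by
            refine (Finset.abs_sum_le_sum_abs _ _).trans (Finset.sum_le_sum fun j _ => ?_)
            rw [abs_mul, abs_of_nonneg (hPr i j)]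
            exact mul_le_mul_of_nonneg_left (ih j _ _) (hPr i j)
        _ = (b * r ^ t) * (u ⬝ᵥ (opL Pr Γ P i *ᵥ u) + v ⬝ᵥ (opL Pr Γ P i *ᵥ v)) := by
            rw [opL_form, opL_form, ← Finset.sum_add_distrib, Finset.mul_sum]
            exact Finset.sum_congr rfl fun j _ => by ring
        _ ≤ (b * r ^ t) * (r * (u ⬝ᵥ (P i *ᵥ u)) + r * (v ⬝ᵥ (P i *ᵥ v))) :=
            mul_le_mul_of_nonneg_left (add_le_add (hr i u) (hr i v)) hbr
        _ = _ := by ring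
  refine tendsto_pi_nhds.mpr fun i => tendsto_pi_nhds.mpr fun a => tendsto_pi_nhds.mpr fun a' => ?_
  have h1 : Tendsto (fun t : ℕ => (b * r ^ t) * ((Pi.single a 1 : Fin d → ℝ) ⬝ᵥ
      (P i *ᵥ Pi.single a 1) + (Pi.single a' 1 : Fin d → ℝ) ⬝ᵥ (P i *ᵥ Pi.single a' 1)))
      atTop (𝓝 0) := by
    have := ((tendsto_pow_atTop_nhds_zero_of_lt_one hr0 hr1).const_mul b).mul_const
      ((Pi.single a 1 : Fin d → ℝ) ⬝ᵥ
      (P i *ᵥ Pi.single a 1) + (Pi.single a' 1 : Fin d → ℝ) ⬝ᵥ (P i *ᵥ Pi.single a' 1))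
    simpa using this
  refine squeeze_zero_norm (fun t => ?_) h1
  have := key t i (Pi.single a 1) (Pi.single a' 1)
  rw [Real.norm_eq_abs]
  refine le_trans (le_of_eq ?_) this
  simp

/-- trace lower bound -/
lemma trace_bound {d : ℕ} (P Sg : Matrix (Fin d) (Fin d) ℝ) (s : ℝ) (hP : P.PosSemidef)
    (hs : ∀ u : Fin d → ℝ, s * (u ⬝ᵥ u) ≤ u ⬝ᵥ (Sg *ᵥ u)) :
    s * P.trace ≤ (P * Sg).trace := by
  obtain ⟨m, v, rfl⟩ := Matrix.posSemidef_iff_eq_sum_vecMulVec.mp hP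
  rw [Finset.sum_mul, Matrix.trace_sum, Matrix.trace_sum, Finset.mul_sum]
  refine Finset.sum_le_sum fun a _ => ?_
  have h1 : (Matrix.vecMulVec (v a) (star (v a)) * Sg).trace = v a ⬝ᵥ (Sg *ᵥ v a) := by
    rw [Matrix.vecMulVec_mul, Matrix.trace_vecMulVec, Matrix.dotProduct_mulVec, dotProduct_comm]
    simp
  have h2 : (Matrix.vecMulVec (v a) (star (v a))).trace = v a ⬝ᵥ v a := by
    rw [Matrix.trace_vecMulVec]
    simp
  rw [h1, h2]
  exact hs _

lemma entry_bound {d : ℕ} (P : Matrix (Fin d) (Fin d) ℝ) (hP : P.PosSemidef) (a b : Fin d) :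
    |P a b| ≤ P.trace := by
  have hd : ∀ a, 0 ≤ P a a := fun a => hP.diag_nonneg
  have ht : ∀ a, P a a ≤ P.trace := fun a =>
    Finset.single_le_sum (f := fun a => P a a) (fun a _ => hd a) (Finset.mem_univ a)
  have hsym : P b a = P a b := by simpa using hP.1.apply a b
  have h1 := hP.dotProduct_mulVec_nonneg (Pi.single a 1 + Pi.single b 1)
  have h2 := hP.dotProduct_mulVec_nonneg (Pi.single a 1 - Pi.single b 1)
  simp [Matrix.mulVec_add, Matrix.mulVec_sub] at h1 h2
  rw [abs_le]
  constructor <;> linarith [ht a, ht b, hd a, hd b]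

lemma lyap_iff {d k N : ℕ} (Pr : Matrix (Fin N) (Fin N) ℝ)
    (A : Fin N → Matrix (Fin d) (Fin d) ℝ) (B : Fin N → Matrix (Fin d) (Fin k) ℝ)
    (Q : Fin N → Matrix (Fin d) (Fin d) ℝ) (R : Fin N → Matrix (Fin k) (Fin k) ℝ)
    (K : Fin N → Matrix (Fin k) (Fin d) ℝ)
    (P : Fin N → Matrix (Fin d) (Fin d) ℝ) :
    IsLyap Pr A B Q R K P ↔
      P = (fun i => Q i + (K i)ᵀ * R i * K i) + opL Pr (Gam A B K) P := by
  rw [funext_iff]; rfl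

lemma stage_posDef {d k N : ℕ} (Q : Fin N → Matrix (Fin d) (Fin d) ℝ) (hQ : ∀ i, (Q i).PosDef)
    (R : Fin N → Matrix (Fin k) (Fin k) ℝ) (hR : ∀ i, (R i).PosDef)
    (K : Fin N → Matrix (Fin k) (Fin d) ℝ) (i : Fin N) :
    (Q i + (K i)ᵀ * R i * K i).PosDef := by
  refine (hQ i).add_posSemidef ?_
  simpa using (hR i).posSemidef.conjTranspose_mul_mul_same (K i)

lemma stab_of_MSS {d k N : ℕ} (Pr : Matrix (Fin N) (Fin N) ℝ)
    (A : Fin N → Matrix (Fin d) (Fin d) ℝ) (B : Fin N → Matrix (Fin d) (Fin k) ℝ)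
    (K : Fin N → Matrix (Fin k) (Fin d) ℝ) (h : MSS Pr A B K) : Stab Pr (Gam A B K) :=
  stab_of_radius _ _ (iter_of_radius _ h)

lemma PK_spec {d k N : ℕ} (Pr : Matrix (Fin N) (Fin N) ℝ)
    (A : Fin N → Matrix (Fin d) (Fin d) ℝ) (B : Fin N → Matrix (Fin d) (Fin k) ℝ)
    (Q : Fin N → Matrix (Fin d) (Fin d) ℝ) (R : Fin N → Matrix (Fin k) (Fin k) ℝ)
    (K : Fin N → Matrix (Fin k) (Fin d) ℝ) (h : MSS Pr A B K) :
    IsLyap Pr A B Q R K (PK Pr A B Q R K) := by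
  have hex : ∃ P, IsLyap Pr A B Q R K P := by
    obtain ⟨P, hP⟩ := exists_fix Pr _ (stab_of_MSS Pr A B K h)
      (fun i => Q i + (K i)ᵀ * R i * K i)
    exact ⟨P, (lyap_iff Pr A B Q R K P).mpr hP⟩
  unfold PK
  rw [dif_pos hex]
  exact hex.choose_spec

/-- coercivity (boundary part): if stabilizing policies `K^l` converge
to a policy on the boundary of `𝕂` (spectral radius of `𝒜` equal to one), the cost
blows up. -/
theorem coercivity_boundary
    (d k N : ℕ) (hd : 0 < d) (hk : 0 < k) (hN : 0 < N)
    (A : Fin N → Matrix (Fin d) (Fin d) ℝ) (B : Fin N → Matrix (Fin d) (Fin k) ℝ)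
    (Pr : Matrix (Fin N) (Fin N) ℝ)
    (hPr : ∀ i j, 0 ≤ Pr i j) (hPrSum : ∀ i, ∑ j, Pr i j = 1)
    (piv : Fin N → ℝ) (hpiv : ∀ i, 0 < piv i) (hpivSum : ∑ i, piv i = 1)
    (Sg : Matrix (Fin d) (Fin d) ℝ) (hSg : Sg.PosDef)
    (Q : Fin N → Matrix (Fin d) (Fin d) ℝ) (hQ : ∀ i, (Q i).PosDef)
    (R : Fin N → Matrix (Fin k) (Fin k) ℝ) (hR : ∀ i, (R i).PosDef)
    (Kl : ℕ → Fin N → Matrix (Fin k) (Fin d) ℝ) (hKl : ∀ l, MSS Pr A B (Kl l))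
    (K : Fin N → Matrix (Fin k) (Fin d) ℝ)
    (hlim : Tendsto Kl atTop (nhds K))
    (hbdry : spectralRadius ℂ ((calA Pr (Gam A B K)).map (algebraMap ℝ ℂ)) = 1) :
    Tendsto (fun l => cost Pr A B Q R piv Sg (Kl l)) atTop atTop := by
  obtain ⟨s, hs0, hs⟩ := posDef_bound Sg hSg
  set P : ℕ → Fin N → Matrix (Fin d) (Fin d) ℝ := fun l => PK Pr A B Q R (Kl l) with hPdef
  have hLy : ∀ l, IsLyap Pr A B Q R (Kl l) (P l) := fun l => PK_spec Pr A B Q R (Kl l) (hKl l)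
  have hpsd : ∀ l i, (P l i).PosSemidef := fun l i =>
    fix_psd Pr hPr _ (stab_of_MSS Pr A B (Kl l) (hKl l)) _ _
      (fun i => (stage_posDef Q hQ R hR (Kl l) i).posSemidef)
      ((lyap_iff Pr A B Q R (Kl l) (P l)).mp (hLy l)) i
  by_contra hnot
  rw [tendsto_atTop] at hnot
  push Not at hnot
  obtain ⟨M, hM⟩ := hnot
  obtain ⟨φ, hφ, hφM⟩ := extraction_of_frequently_atTop hM
  -- entries are bounded along the subsequence
  have hbd : ∀ n i a b, |P (φ n) i a b| ≤ M / (piv i * s) := by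
    intro n i a b
    refine (entry_bound _ (hpsd _ i) a b).trans ?_
    have hps : 0 < piv i * s := mul_pos (hpiv i) hs0
    rw [le_div_iff₀ hps]
    have h1 : ∀ j, piv j * (s * (P (φ n) j).trace) ≤ piv j * (P (φ n) j * Sg).trace := fun j =>
      mul_le_mul_of_nonneg_left (trace_bound _ _ s (hpsd _ j) hs) (hpiv j).le
    have h0 : ∀ j, 0 ≤ piv j * (P (φ n) j * Sg).trace := fun j =>
      (mul_nonneg (hpiv j).le (mul_nonneg hs0.le (hpsd _ j).trace_nonneg)).trans (h1 j)
    have h2 : piv i * (P (φ n) i * Sg).trace ≤ cost Pr A B Q R piv Sg (Kl (φ n)) :=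
      Finset.single_le_sum (f := fun j => piv j * (P (φ n) j * Sg).trace)
        (fun j _ => h0 j) (Finset.mem_univ i)
    have h3 := hφM n
    have h4 := h1 i
    nlinarith
  have hcomp : IsCompact (Set.univ.pi fun i : Fin N => Set.univ.pi fun _ : Fin d =>
      Set.univ.pi fun _ : Fin d => Set.Icc (-(M / (piv i * s))) (M / (piv i * s))) :=
    isCompact_univ_pi fun i => isCompact_univ_pi fun _ => isCompact_univ_pi fun _ => isCompact_Icc
  obtain ⟨P0, -, ψ, hψ, hlimP⟩ := hcomp.tendsto_subseq 
    (x := (fun n i a b => P (φ n) i a b : ℕ → Fin N → Fin d → Fin d → ℝ))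
    (fun n i _ a _ b _ => abs_le.mp (hbd n i a b))
  let P1 : Fin N → Matrix (Fin d) (Fin d) ℝ := P0
  have hlimP1 : Tendsto (fun n => P (φ (ψ n))) atTop (𝓝 P1) := hlimP
  have hlimK : Tendsto (fun n => Kl (φ (ψ n))) atTop (𝓝 K) :=
    hlim.comp (hφ.tendsto_atTop.comp hψ.tendsto_atTop)
  have hP1psd : ∀ i, (P1 i).PosSemidef := fun i =>
    posSemidef_of_tendsto _ _ (fun n => hpsd (φ (ψ n)) i) (tendsto_pi_nhds.mp hlimP1 i)
  have hP1 : IsLyap Pr A B Q R K P1 := by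
    intro i
    have hc : Continuous fun z : (Fin N → Matrix (Fin k) (Fin d) ℝ) ×
        (Fin N → Matrix (Fin d) (Fin d) ℝ) =>
        Q i + (z.1 i)ᵀ * R i * z.1 i + (Gam A B z.1 i)ᵀ * opE Pr z.2 i * Gam A B z.1 i := by
      unfold Gam opE
      fun_prop
    have h1 := (hc.tendsto (K, P1)).comp (hlimK.prodMk_nhds hlimP1)
    refine tendsto_nhds_unique (tendsto_pi_nhds.mp hlimP1 i) (h1.congr fun n => ?_)
    exact (hLy (φ (ψ n)) i).symm
  have hstab := stab_of_lyap Pr hPr (Gam A B K) _ P1 (stage_posDef Q hQ R hR K) hP1psd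
    ((lyap_iff Pr A B Q R K P1).mp hP1)
  have : Nonempty (Fin N × Fin d × Fin d) := ⟨(⟨0, hN⟩, ⟨0, hd⟩, ⟨0, hd⟩)⟩
  have := radius_of_iter _ (radius_of_stab _ _ hstab)
  exact absurd hbdry this.ne

end MJLS
end
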